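/- Let N ≥ 1, and for each i ∈ {1,…,N} let I_i be a nonempty finite subset of {0,1,…,i−1} and let Δ_{i,j} : ℝ^p → ℝ^p be linear maps for j ∈ I_i. Suppose the vectors ỹ_{i,t} ∈ ℝ^p (for i ∈ {0,1,…,N} and t ∈ ℕ) satisfy ỹ_{0,t} = 0 for all t, and for each i ∈ {1,…,N} and all t, ỹ_{i,t+1} = (1/|I_i|) Σ_{j ∈ I_i} Δ_{i,j}(ỹ_{j,t}). Then ỹ_{i,t} = 0 for all t ≥ i; in particular, ỹ_{i,t} = 0 for every i ∈ {1,…,N} and every t ≥ N. -/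

import Mathlib

/-- Platoon terminal-error recursion (abstract form of Theorem 1): vehicles are
indexed `0, 1, …, N`; the leader's error `ỹ 0 t` is identically zero, and each
follower `i ≥ 1` averages linear images of the errors of a nonempty set `I i`
of strictly preceding vehicles.  Then `ỹ i t = 0` for all `t ≥ i`; in
particular `ỹ i t = 0` for every `i` and every `t ≥ N`. -/
theorem platoon_terminal_error_vanishes {N p : ℕ} (hN : 1 ≤ N)
    (I : Fin (N + 1) → Finset (Fin (N + 1)))
    (hne : ∀ i : Fin (N + 1), i ≠ 0 → (I i).Nonempty)
    (hpre : ∀ i : Fin (N + 1), i ≠ 0 → ∀ j ∈ I i, j < i)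
    (Δ : Fin (N + 1) → Fin (N + 1) → (Fin p → ℝ) →ₗ[ℝ] (Fin p → ℝ))
    (y : Fin (N + 1) → ℕ → (Fin p → ℝ))
    (hleader : ∀ t : ℕ, y 0 t = 0)
    (hrec : ∀ i : Fin (N + 1), i ≠ 0 → ∀ t : ℕ,
      y i (t + 1) = ((I i).card : ℝ)⁻¹ • ∑ j ∈ I i, Δ i j (y j t)) :
    (∀ (i : Fin (N + 1)) (t : ℕ), (i : ℕ) ≤ t → y i t = 0) ∧
      (∀ (i : Fin (N + 1)) (t : ℕ), N ≤ t → y i t = 0) := by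
  have vanish : ∀ (t : ℕ) (i : Fin (N + 1)), (i : ℕ) ≤ t → y i t = 0 := by
    intro t
    induction t with
    | zero =>
      intro i hi
      obtain rfl : i = 0 := Fin.ext (Nat.le_zero.mp hi)
      exact hleader 0
    | succ t ih =>
      intro i hi
      by_cases h0 : i = 0
      · rw [h0, hleader]
      · rw [hrec i h0, Finset.sum_eq_zero, smul_zero]
        intro j hj
        have hlt : (j : ℕ) < i := hpre i h0 j hj
        rw [ih j (by omega), map_zero]
  exact ⟨fun i t hi => vanish t i hi,
    fun i t ht => vanish t i ((Nat.lt_succ_iff.mp i.isLt).trans ht)⟩
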